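/- Let G be an invertible n×n real matrix whose rows g₁,…,gₙ satisfy G·Gᵀ = Jₙ + Iₙ (the Aₙ basis). The number of pairs (x, x') with x ∈ C¹, x' ∈ T_f(x) ∩ C⁰, such that both x and x' lie on the non-negative side of every bisector hyperplane, i.e. ⟨x, g_j − g_k⟩ ≥ 0 and ⟨x', g_j − g_k⟩ ≥ 0 for all 2 ≤ j < k ≤ n, equals exactly 2n − 1. (This is the number of affine pieces of the decision boundary function remaining after the folding procedure, reduced from the exponential count Σ_{i=1}^{n} i·C(n−1,n−i).) -/

import Mathlib

open Matrix Finset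

/-- Euclidean norm of a vector in `ℝⁿ`. -/
noncomputable def nrm {n : ℕ} (v : Fin n → ℝ) : ℝ := Real.sqrt (∑ i, v i ^ 2)

/-- The lattice generated by the rows of `G`. -/
def latticePt {n : ℕ} (G : Matrix (Fin n) (Fin n) ℝ) (x : Fin n → ℝ) : Prop :=
  ∃ z : Fin n → ℤ, x = (fun i => (z i : ℝ)) ᵥ* G

/-- The Voronoi region of `x` in the lattice generated by `G`. -/
def Vor {n : ℕ} (G : Matrix (Fin n) (Fin n) ℝ) (x : Fin n → ℝ) : Set (Fin n → ℝ) :=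
  {y | ∀ lam : Fin n → ℝ, latticePt G lam → nrm (y - x) ≤ nrm (y - lam)}

/-- `x'` shares an `(n−1)`-dimensional Voronoi facet with `x`. -/
def sharesFacet {n : ℕ} (G : Matrix (Fin n) (Fin n) ℝ) (x x' : Fin n → ℝ) : Prop :=
  Module.finrank ℝ (affineSpan ℝ (Vor G x ∩ Vor G x')).direction = n - 1

/-- The corner set `C^b = {zG : z ∈ {0,1}ⁿ, z₁ = b}`. -/
def cornerSet {n : ℕ} [NeZero n] (G : Matrix (Fin n) (Fin n) ℝ) (b : ℝ) :
    Set (Fin n → ℝ) :=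
  {x | ∃ z : Fin n → ℝ, (∀ i, z i = 0 ∨ z i = 1) ∧ z 0 = b ∧ x = z ᵥ* G}

lemma nrm_le_nrm_iff {n : ℕ} (a b : Fin n → ℝ) : nrm a ≤ nrm b ↔ a ⬝ᵥ a ≤ b ⬝ᵥ b := by
  have h : ∀ v : Fin n → ℝ, ∑ i, v i ^ 2 = v ⬝ᵥ v := fun v => by
    simp only [dotProduct, sq]
  unfold nrm
  rw [Real.sqrt_le_sqrt_iff (Finset.sum_nonneg fun i _ => sq_nonneg _), h, h]

/-- The lattice point with integer coordinates `z` in the basis formed by the rows of `G`. -/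
noncomputable def intComb {n : ℕ} (G : Matrix (Fin n) (Fin n) ℝ) (z : Fin n → ℤ) : Fin n → ℝ :=
  (fun i => (z i : ℝ)) ᵥ* G

section intComb

variable {n : ℕ} (G : Matrix (Fin n) (Fin n) ℝ)

lemma intComb_add (a b : Fin n → ℤ) : intComb G (a + b) = intComb G a + intComb G b := by
  simp only [intComb, ← Matrix.add_vecMul]
  congr 1
  ext i
  simp

lemma intComb_neg (a : Fin n → ℤ) : intComb G (-a) = -intComb G a := by
  simp only [intComb, ← Matrix.neg_vecMul]
  congr 1
  ext i
  simp

lemma intComb_sub (a b : Fin n → ℤ) : intComb G (a - b) = intComb G a - intComb G b := by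
  rw [sub_eq_add_neg, intComb_add, intComb_neg, sub_eq_add_neg]

lemma intComb_dotProduct (z : Fin n → ℤ) (w : Fin n → ℝ) :
    intComb G z ⬝ᵥ w = ∑ i, (z i : ℝ) * (G i ⬝ᵥ w) := by
  rw [intComb, ← Matrix.dotProduct_mulVec]
  rfl

lemma intComb_injective (hG : IsUnit G.det) : Function.Injective (intComb G) := by
  intro a b h
  have h2 := Matrix.vecMul_injective_of_isUnit ((Matrix.isUnit_iff_isUnit_det G).2 hG) h
  ext i
  exact_mod_cast congrFun h2 i

lemma mem_Vor_intComb_iff (a : Fin n → ℤ) (y : Fin n → ℝ) :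
    y ∈ Vor G (intComb G a) ↔ ∀ z : Fin n → ℤ,
      2 * (intComb G z ⬝ᵥ (y - intComb G a)) ≤ intComb G z ⬝ᵥ intComb G z := by
  have key : ∀ u v : Fin n → ℝ, u ⬝ᵥ u ≤ (u - v) ⬝ᵥ (u - v) ↔ 2 * (v ⬝ᵥ u) ≤ v ⬝ᵥ v := by
    intro u v
    rw [sub_dotProduct, dotProduct_sub, dotProduct_sub, dotProduct_comm u v]
    constructor <;> intro h <;> linarith
  constructor
  · intro h z
    have h1 := h (intComb G (a + z)) ⟨_, rfl⟩
    rwa [nrm_le_nrm_iff, intComb_add, ← sub_sub, key] at h1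
  · rintro h _ ⟨z, rfl⟩
    have h1 := h (z - a)
    rw [nrm_le_nrm_iff]
    rw [← key, intComb_sub] at h1
    convert h1 using 2 <;> simp [intComb]

end intComb

section Gram

variable {n : ℕ} {G : Matrix (Fin n) (Fin n) ℝ}

lemma vecMul_dotProduct_vecMul_of_gram
    (hGram : G * G.transpose = Matrix.of (fun _ _ => (1 : ℝ)) + 1) (a b : Fin n → ℝ) :
    (a ᵥ* G) ⬝ᵥ (b ᵥ* G) = (∑ i, a i) * (∑ i, b i) + ∑ i, a i * b i := by
  have h : (Matrix.of (fun _ _ => (1 : ℝ)) : Matrix (Fin n) (Fin n) ℝ) *ᵥ b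
      = fun _ => ∑ i, b i := by
    ext i
    simp [Matrix.mulVec, dotProduct]
  rw [← Matrix.dotProduct_mulVec, ← Matrix.mulVec_transpose, Matrix.mulVec_mulVec, hGram,
    Matrix.add_mulVec, Matrix.one_mulVec, h, dotProduct_add]
  simp [dotProduct, Finset.sum_mul]

lemma intComb_dotProduct_intComb
    (hGram : G * G.transpose = Matrix.of (fun _ _ => (1 : ℝ)) + 1) (a b : Fin n → ℤ) :
    intComb G a ⬝ᵥ intComb G b = (((∑ i, a i) * (∑ i, b i) + ∑ i, a i * b i : ℤ) : ℝ) := by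
  rw [intComb, intComb, vecMul_dotProduct_vecMul_of_gram hGram]
  push_cast
  rfl

lemma vecMul_dotProduct_row_sub
    (hGram : G * G.transpose = Matrix.of (fun _ _ => (1 : ℝ)) + 1) (z : Fin n → ℝ)
    (j k : Fin n) : ∑ t, (z ᵥ* G) t * (G j t - G k t) = z j - z k := by
  have h := vecMul_dotProduct_vecMul_of_gram hGram z (Pi.single j 1 - Pi.single k 1)
  rw [Matrix.sub_vecMul, Matrix.single_one_vecMul, Matrix.single_one_vecMul] at h
  simpa [dotProduct, mul_sub, Finset.sum_sub_distrib, Pi.single_apply] using h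

end Gram

/-- The linear functional `v ↦ d ⬝ᵥ v`. -/
def dotLin {n : ℕ} (d : Fin n → ℝ) : (Fin n → ℝ) →ₗ[ℝ] ℝ where
  toFun v := d ⬝ᵥ v
  map_add' := dotProduct_add d
  map_smul' c v := dotProduct_smul c d v

lemma mem_ker_dotLin {n : ℕ} {d v : Fin n → ℝ} : v ∈ LinearMap.ker (dotLin d) ↔ d ⬝ᵥ v = 0 :=
  LinearMap.mem_ker

lemma direction_affineSpan_le_ker_dotLin {n : ℕ} {d : Fin n → ℝ} {c : ℝ} {s : Set (Fin n → ℝ)}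
    (h : ∀ y ∈ s, d ⬝ᵥ y = c) : (affineSpan ℝ s).direction ≤ LinearMap.ker (dotLin d) := by
  rw [direction_affineSpan, vectorSpan_def, Submodule.span_le]
  rintro _ ⟨y, hy, y', hy', rfl⟩
  have : d ⬝ᵥ (y - y') = 0 := by rw [dotProduct_sub, h y hy, h y' hy', sub_self]
  exact mem_ker_dotLin.2 this

lemma finrank_ker_dotLin {n : ℕ} {d : Fin n → ℝ} (hd : d ≠ 0) :
    Module.finrank ℝ (LinearMap.ker (dotLin d)) = n - 1 := by
  have hs : LinearMap.range (dotLin d) = ⊤ := by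
    refine LinearMap.range_eq_top.2 (LinearMap.surjective fun h => hd ?_)
    have : d ⬝ᵥ d = 0 := LinearMap.congr_fun h d
    exact dotProduct_self_eq_zero.1 this
  have h := LinearMap.finrank_range_add_finrank_ker (dotLin d)
  rw [hs, finrank_top] at h
  simp only [Module.finrank_self, Module.finrank_fin_fun] at h
  omega

section Facets

variable {n : ℕ} {G : Matrix (Fin n) (Fin n) ℝ}

/-- On the common boundary of two Voronoi regions, `2⟨d, w⟩ = ⟨d, d⟩`. -/
lemma two_mul_dotProduct_eq_of_mem_Vor_inter {b d : Fin n → ℤ} {y : Fin n → ℝ}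
    (hy : y ∈ Vor G (intComb G (b + d)) ∩ Vor G (intComb G b)) :
    2 * (intComb G d ⬝ᵥ (y - intComb G b)) = intComb G d ⬝ᵥ intComb G d := by
  have h1 := (mem_Vor_intComb_iff G _ _).1 hy.1 (-d)
  have h2 := (mem_Vor_intComb_iff G _ _).1 hy.2 d
  rw [intComb_neg, intComb_add, ← sub_sub, neg_dotProduct_neg, neg_dotProduct,
    dotProduct_sub _ (y - intComb G b)] at h1
  linarith

/-- If the difference of two lattice points splits as a sum of two nonzero lattice vectors at a
non-obtuse angle, then the points do not share a Voronoi facet. -/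
lemma not_sharesFacet_of_dotProduct_nonneg (hn : 2 ≤ n) {b d₁ d₂ : Fin n → ℤ}
    (h₁ : intComb G d₁ ≠ 0) (h₂ : intComb G d₂ ≠ 0)
    (h : 0 ≤ intComb G d₁ ⬝ᵥ intComb G d₂) :
    ¬ sharesFacet G (intComb G (b + (d₁ + d₂))) (intComb G b) := by
  unfold sharesFacet
  set s := Vor G (intComb G (b + (d₁ + d₂))) ∩ Vor G (intComb G b)
  have key : ∀ y ∈ s, intComb G d₁ ⬝ᵥ intComb G d₂ = 0 ∧
      2 * (intComb G d₁ ⬝ᵥ (y - intComb G b)) = intComb G d₁ ⬝ᵥ intComb G d₁ ∧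
      2 * (intComb G d₂ ⬝ᵥ (y - intComb G b)) = intComb G d₂ ⬝ᵥ intComb G d₂ := by
    intro y hy
    have e := two_mul_dotProduct_eq_of_mem_Vor_inter hy
    have e₁ := (mem_Vor_intComb_iff G _ _).1 hy.2 d₁
    have e₂ := (mem_Vor_intComb_iff G _ _).1 hy.2 d₂
    rw [intComb_add, add_dotProduct, add_dotProduct, dotProduct_add, dotProduct_add,
      dotProduct_comm (intComb G d₂) (intComb G d₁)] at e
    refine ⟨?_, ?_, ?_⟩ <;> linarith
  rcases s.eq_empty_or_nonempty with hs | ⟨y₀, hy₀⟩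
  · rw [hs, direction_affineSpan, vectorSpan_empty, finrank_bot]
    omega
  · have horth := (key y₀ hy₀).1
    have l₁ : (affineSpan ℝ s).direction ≤ LinearMap.ker (dotLin (intComb G d₁)) :=
      direction_affineSpan_le_ker_dotLin
        (c := intComb G d₁ ⬝ᵥ intComb G d₁ / 2 + intComb G d₁ ⬝ᵥ intComb G b) fun y hy => by
          have := (key y hy).2.1
          rw [dotProduct_sub] at this
          linarith
    have l₂ : (affineSpan ℝ s).direction ≤ LinearMap.ker (dotLin (intComb G d₂)) :=
      direction_affineSpan_le_ker_dotLin
        (c := intComb G d₂ ⬝ᵥ intComb G d₂ / 2 + intComb G d₂ ⬝ᵥ intComb G b) fun y hy => by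
          have := (key y hy).2.2
          rw [dotProduct_sub] at this
          linarith
    have hlt : (affineSpan ℝ s).direction < LinearMap.ker (dotLin (intComb G d₁)) := by
      refine lt_of_le_of_ne l₁ fun he => h₂ ?_
      have : intComb G d₂ ∈ (affineSpan ℝ s).direction := he ▸ mem_ker_dotLin.2 horth
      exact dotProduct_self_eq_zero.1 (mem_ker_dotLin.1 (l₂ this))
    have := Submodule.finrank_lt_finrank_of_lt hlt
    rw [finrank_ker_dotLin h₁] at this
    exact this.ne

lemma exists_pos_forall_mul_le {ι : Type*} [Fintype ι] (f : ι → ℝ) :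
    ∃ t : ℝ, 0 < t ∧ ∀ i, |t * f i| ≤ 1 / 2 := by
  have hpos : 0 ≤ ∑ i, |f i| := Finset.sum_nonneg fun i _ => abs_nonneg _
  refine ⟨1 / (2 * (1 + ∑ i, |f i|)), by positivity, fun i => ?_⟩
  have hi : |f i| ≤ ∑ i, |f i| :=
    Finset.single_le_sum (f := fun i => |f i|) (fun i _ => abs_nonneg _) (Finset.mem_univ i)
  rw [abs_mul, abs_of_pos (by positivity), div_mul_eq_mul_div, div_le_div_iff₀ (by positivity)
    (by norm_num)]
  linarith

/-- If the functional `z ↦ ⟨z, z - d⟩` dominates every small functional vanishing at `d`, then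
lattice points differing by `d` share a Voronoi facet. -/
lemma sharesFacet_of_forall_le {b d : Fin n → ℤ} (hd : intComb G d ≠ 0)
    (h : ∀ ω : Fin n → ℝ, (∀ i, |ω i| ≤ 1 / 2) → ∑ i, (d i : ℝ) * ω i = 0 → ∀ z : Fin n → ℤ,
      ∑ i, (z i : ℝ) * ω i ≤ intComb G z ⬝ᵥ intComb G z - intComb G z ⬝ᵥ intComb G d) :
    sharesFacet G (intComb G (b + d)) (intComb G b) := by
  unfold sharesFacet
  rw [← finrank_ker_dotLin hd]
  suffices he : (affineSpan ℝ (Vor G (intComb G (b + d)) ∩ Vor G (intComb G b))).direction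
      = LinearMap.ker (dotLin (intComb G d)) by rw [he]
  set s := Vor G (intComb G (b + d)) ∩ Vor G (intComb G b)
  refine le_antisymm ?_ fun w hw => ?_
  · refine direction_affineSpan_le_ker_dotLin
      (c := intComb G d ⬝ᵥ intComb G d / 2 + intComb G d ⬝ᵥ intComb G b) fun y hy => ?_
    have := two_mul_dotProduct_eq_of_mem_Vor_inter hy
    rw [dotProduct_sub] at this
    linarith
  have mem : ∀ v : Fin n → ℝ, intComb G d ⬝ᵥ v = 0 → (∀ i, |2 * (G i ⬝ᵥ v)| ≤ 1 / 2) →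
      intComb G b + (1 / 2 : ℝ) • intComb G d + v ∈ s := by
    intro v hv hsmall
    have bound : ∀ z : Fin n → ℤ, 2 * (intComb G z ⬝ᵥ v) ≤
        intComb G z ⬝ᵥ intComb G z - intComb G z ⬝ᵥ intComb G d := fun z => by
      have := h (fun i => 2 * (G i ⬝ᵥ v)) hsmall (by
        rw [intComb_dotProduct] at hv
        simp only [mul_left_comm _ (2 : ℝ), ← Finset.mul_sum, hv, mul_zero]) z
      simpa only [mul_left_comm _ (2 : ℝ), ← Finset.mul_sum, ← intComb_dotProduct] using this
    have bound' : ∀ z : Fin n → ℤ, 2 * (intComb G z ⬝ᵥ -v) ≤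
        intComb G z ⬝ᵥ intComb G z - intComb G z ⬝ᵥ intComb G d := fun z => by
      have := h (fun i => 2 * (G i ⬝ᵥ -v)) (fun i => by simpa using hsmall i) (by
        rw [intComb_dotProduct] at hv
        simp only [dotProduct_neg, mul_neg, Finset.sum_neg_distrib, mul_left_comm _ (2 : ℝ),
          ← Finset.mul_sum, hv, mul_zero, neg_zero]) z
      simpa only [mul_left_comm _ (2 : ℝ), ← Finset.mul_sum, ← intComb_dotProduct] using this
    constructor
    · refine (mem_Vor_intComb_iff G _ _).2 fun z => ?_
      have e : intComb G b + (1 / 2 : ℝ) • intComb G d + v - intComb G (b + d)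
          = v - (1 / 2 : ℝ) • intComb G d := by
        rw [intComb_add]
        module
      have := bound' (-z)
      rw [intComb_neg, neg_dotProduct_neg, neg_dotProduct_neg, neg_dotProduct] at this
      rw [e, dotProduct_sub, dotProduct_smul, smul_eq_mul]
      linarith
    · refine (mem_Vor_intComb_iff G _ _).2 fun z => ?_
      have e : intComb G b + (1 / 2 : ℝ) • intComb G d + v - intComb G b
          = v + (1 / 2 : ℝ) • intComb G d := by
        module
      have := bound z
      rw [e, dotProduct_add, dotProduct_smul, smul_eq_mul]
      linarith
  obtain ⟨t, ht, hsmall⟩ := exists_pos_forall_mul_le fun i => 2 * (G i ⬝ᵥ w)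
  rw [mem_ker_dotLin] at hw
  have m₁ := mem (t • w) (by rw [dotProduct_smul, hw, smul_zero]) fun i => by
    rw [dotProduct_smul, smul_eq_mul, mul_left_comm]
    exact hsmall i
  have m₀ := mem 0 (dotProduct_zero _) fun i => by
    rw [dotProduct_zero]
    norm_num
  have hdir := AffineSubspace.vsub_mem_direction (mem_affineSpan ℝ m₁) (mem_affineSpan ℝ m₀)
  rw [vsub_eq_sub, add_zero, add_sub_cancel_left] at hdir
  exact (Submodule.smul_mem_iff _ ht.ne').1 hdir

end Facets

lemma int_mul_le_half_sq (z : ℤ) {r : ℝ} (hr : |r| ≤ 1 / 2) : (z : ℝ) * r ≤ (z : ℝ) ^ 2 / 2 := by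
  have h : |(z : ℝ)| ≤ (z : ℝ) ^ 2 := by
    rw [← sq_abs]
    have : |z| ≤ |z| ^ 2 := Int.le_self_sq _
    exact_mod_cast this
  calc (z : ℝ) * r ≤ |(z : ℝ)| * |r| := by rw [← abs_mul]; exact le_abs_self _
    _ ≤ (z : ℝ) ^ 2 * (1 / 2) := by gcongr
    _ = _ := by ring

lemma sum_int_mul_le_half_sum_sq {ι : Type*} (s : Finset ι) (z : ι → ℤ) (ω : ι → ℝ)
    (hω : ∀ i, |ω i| ≤ 1 / 2) :
    ∑ i ∈ s, (z i : ℝ) * ω i ≤ (∑ i ∈ s, (z i : ℝ) ^ 2) / 2 := by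
  rw [Finset.sum_div]
  exact Finset.sum_le_sum fun i _ => int_mul_le_half_sq _ (hω i)

section Roots

variable {n : ℕ} {G : Matrix (Fin n) (Fin n) ℝ}

lemma intComb_ne_zero (hG : IsUnit G.det) {d : Fin n → ℤ} (hd : d ≠ 0) : intComb G d ≠ 0 := by
  intro h
  refine hd (intComb_injective G hG (h.trans ?_))
  simp [intComb, ← Pi.zero_def]

lemma sharesFacet_add_single (hG : IsUnit G.det)
    (hGram : G * G.transpose = Matrix.of (fun _ _ => (1 : ℝ)) + 1) (b : Fin n → ℤ) (a : Fin n) :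
    sharesFacet G (intComb G (b + Pi.single a 1)) (intComb G b) := by
  refine sharesFacet_of_forall_le (intComb_ne_zero hG (by simp)) fun ω hω h0 z => ?_
  have ha : ω a = 0 := by simpa [Pi.single_apply] using h0
  rw [intComb_dotProduct_intComb hGram, intComb_dotProduct_intComb hGram]
  have hb := sum_int_mul_le_half_sum_sq (Finset.univ.erase a) z ω hω
  have hz : (z a : ℝ) ≤ (z a : ℝ) ^ 2 := by exact_mod_cast Int.le_self_sq (z a)
  have hS : (∑ i, (z i : ℝ)) ≤ (∑ i, (z i : ℝ)) ^ 2 := by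
    exact_mod_cast Int.le_self_sq (∑ i, z i)
  have hnn : 0 ≤ ∑ i ∈ Finset.univ.erase a, (z i : ℝ) ^ 2 :=
    Finset.sum_nonneg fun i _ => sq_nonneg _
  push_cast
  simp only [← sq, Pi.single_apply, Int.cast_ite, Int.cast_one, Int.cast_zero, mul_ite, mul_one,
    mul_zero, Finset.sum_ite_eq', Finset.mem_univ, if_true]
  rw [← Finset.add_sum_erase _ _ (Finset.mem_univ a),
    ← Finset.add_sum_erase _ (fun i => (z i : ℝ) ^ 2) (Finset.mem_univ a), ha]
  linarith

lemma sharesFacet_add_single_sub_single (hG : IsUnit G.det)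
    (hGram : G * G.transpose = Matrix.of (fun _ _ => (1 : ℝ)) + 1) (b : Fin n → ℤ)
    {a c : Fin n} (hac : a ≠ c) :
    sharesFacet G (intComb G (b + (Pi.single a 1 - Pi.single c 1))) (intComb G b) := by
  refine sharesFacet_of_forall_le (intComb_ne_zero hG fun h => ?_) fun ω hω h0 z => ?_
  · simpa [hac] using congrFun h a
  have ha : ω c = ω a := by
    have : ω a - ω c = 0 := by simpa [Pi.single_apply, sub_mul, Finset.sum_sub_distrib] using h0
    linarith
  rw [intComb_dotProduct_intComb hGram, intComb_dotProduct_intComb hGram]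
  have split : ∀ f : Fin n → ℝ,
      ∑ i, f i = f a + (f c + ∑ i ∈ (Finset.univ.erase a).erase c, f i) := fun f => by
    rw [Finset.add_sum_erase _ _ (by simp [hac.symm]), Finset.add_sum_erase _ _ (Finset.mem_univ a)]
  set T := (Finset.univ.erase a).erase c
  have hb := sum_int_mul_le_half_sum_sq T z (fun i => ω i) hω
  have hb' := sum_int_mul_le_half_sum_sq T z (fun _ => -ω a) (fun i => by simpa using hω a)
  rw [← Finset.sum_mul] at hb'
  have hS := int_mul_le_half_sq (∑ i, z i) (hω a)
  push_cast at hS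
  have hz : (z a : ℝ) ≤ (z a : ℝ) ^ 2 := by exact_mod_cast Int.le_self_sq (z a)
  have hz' : -(z c : ℝ) ≤ (z c : ℝ) ^ 2 := by
    have := Int.le_self_sq (-z c)
    rw [neg_sq] at this
    exact_mod_cast this
  push_cast
  simp only [Pi.sub_apply, Pi.single_apply, Int.cast_sub, Int.cast_ite, Int.cast_one,
    Int.cast_zero, mul_sub, Finset.sum_sub_distrib, mul_ite, mul_one,
    mul_zero, Finset.sum_ite_eq', Finset.mem_univ, if_true, sub_self, ← sq]
  rw [split (fun i => (z i : ℝ) * ω i), split (fun i => (z i : ℝ) ^ 2), ha]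
  have hs := split (fun i => (z i : ℝ))
  have hS2 : (z a + z c : ℝ) * ω a = (∑ i, (z i : ℝ)) * ω a + (∑ i ∈ T, (z i : ℝ)) * (-ω a) := by
    rw [hs]
    ring
  have hnn : 0 ≤ (∑ i, (z i : ℝ)) ^ 2 := sq_nonneg _
  linarith

end Roots

section Pieces

variable {n : ℕ}

/-- The corner of `C¹` whose coordinates are `1` exactly at the indices up to `m`. -/
def upperCorner (m : Fin n) : Fin n → ℤ := fun i => if i ≤ m then 1 else 0

lemma upperCorner_injective : Function.Injective (upperCorner (n := n)) := by
  intro a b h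
  have h₁ := congrFun h a
  have h₂ := congrFun h b
  simp only [upperCorner, le_refl, if_true] at h₁ h₂
  refine le_antisymm ?_ ?_
  · by_contra hc
    simp [hc] at h₁
  · by_contra hc
    simp [hc] at h₂

variable [NeZero n]

/-- The corner of `C⁰` whose coordinates are `1` exactly at the nonzero indices up to `m`. -/
def lowerCorner (m : Fin n) : Fin n → ℤ := fun i => if i ≠ 0 ∧ i ≤ m then 1 else 0

lemma upperCorner_eq_lowerCorner_add (m : Fin n) :
    upperCorner m = lowerCorner m + Pi.single 0 1 := by
  ext i
  rcases eq_or_ne i 0 with rfl | hi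
  · simp [upperCorner, lowerCorner]
  · simp [upperCorner, lowerCorner, hi]

lemma lowerCorner_injective : Function.Injective (lowerCorner (n := n)) := fun a b h =>
  upperCorner_injective <| by rw [upperCorner_eq_lowerCorner_add, upperCorner_eq_lowerCorner_add, h]

lemma upperCorner_eq_of_val_eq_add_one {m k : Fin n} (h : (k : ℕ) = m + 1) :
    upperCorner m = lowerCorner k + (Pi.single 0 1 - Pi.single k 1) := by
  ext i
  have h0 : ((0 : Fin n) : ℕ) = 0 := Fin.val_zero n
  simp only [upperCorner, lowerCorner, Pi.add_apply, Pi.sub_apply, Pi.single_apply, Fin.ext_iff,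
    Fin.le_def, ne_eq]
  split_ifs <;> omega

/-- A monotone `0`-`1` vector on the nonzero indices is a truncated indicator. -/
lemma exists_forall_eq_ite_of_monotone {z : Fin n → ℝ} (hz : ∀ i, z i = 0 ∨ z i = 1)
    (hmono : ∀ j k : Fin n, 1 ≤ (j : ℕ) → j < k → z k ≤ z j) :
    ∃ m : Fin n, ∀ i, i ≠ 0 → z i = if i ≤ m then 1 else 0 := by
  classical
  obtain ⟨m, hm, hmax⟩ := (Finset.univ.filter fun i => i = 0 ∨ z i = 1).exists_max_image id
    ⟨0, by simp⟩
  simp only [Finset.mem_filter, Finset.mem_univ, true_and, id] at hm hmax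
  refine ⟨m, fun i hi => ?_⟩
  split_ifs with him
  · have hi' : 1 ≤ (i : ℕ) := Nat.one_le_iff_ne_zero.2 fun h => hi (Fin.ext (by simpa using h))
    have hzm : z m = 1 := hm.resolve_left fun h => hi (le_antisymm (h ▸ him) (Fin.zero_le i))
    rcases him.eq_or_lt with rfl | hlt
    · exact hzm
    · have := hmono i m hi' hlt
      rcases hz i with h | h <;> linarith
  · exact (hz i).resolve_right fun h => him (hmax i (Or.inr h))

variable {G : Matrix (Fin n) (Fin n) ℝ}

lemma sharesFacet_corner_iff (hG : IsUnit G.det)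
    (hGram : G * G.transpose = Matrix.of (fun _ _ => (1 : ℝ)) + 1) (m k : Fin n) :
    sharesFacet G (intComb G (upperCorner m)) (intComb G (lowerCorner k)) ↔
      k = m ∨ (k : ℕ) = m + 1 := by
  have h0 : ((0 : Fin n) : ℕ) = 0 := Fin.val_zero n
  have single_ne {d : Fin n → ℤ} (i : Fin n) (hi : d i ≠ 0) : intComb G d ≠ 0 :=
    intComb_ne_zero hG fun h => hi (congrFun h i)
  constructor
  · intro hs
    by_contra! hne
    rcases lt_or_gt_of_ne hne.1 with hlt | hlt
    · set r : Fin n → ℤ := fun i => if k < i ∧ i ≤ m then 1 else 0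
      have e : upperCorner m = lowerCorner k + (Pi.single 0 1 + r) := by
        ext i
        simp only [upperCorner, lowerCorner, Pi.add_apply, Pi.single_apply, r, Fin.ext_iff,
          Fin.le_def, Fin.lt_def, ne_eq] at hlt ⊢
        split_ifs <;> omega
      rw [e] at hs
      refine not_sharesFacet_of_dotProduct_nonneg ?_ (single_ne 0 (by simp))
        (single_ne m (by simp [r, hlt])) ?_ hs
      · have := m.isLt
        have := Fin.lt_def.1 hlt
        omega
      · have hr : ∀ i, 0 ≤ r i := fun i => by
          simp only [r]
          split_ifs <;> norm_num
        rw [intComb_dotProduct_intComb hGram]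
        have := Finset.sum_nonneg fun i (_ : i ∈ Finset.univ) => hr i
        have := hr 0
        simp only [Pi.single_apply, ite_mul, one_mul, zero_mul, Finset.sum_ite_eq',
          Finset.mem_univ, if_true]
        exact_mod_cast by linarith
    · have hlt' := Fin.lt_def.1 hlt
      obtain ⟨j, hj⟩ : ∃ j : Fin n, (j : ℕ) = m + 1 := ⟨⟨m + 1, by omega⟩, rfl⟩
      set r : Fin n → ℤ := fun i => if j < i ∧ i ≤ k then 1 else 0
      have hjk : j < k := Fin.lt_def.2 (by omega)
      have e : upperCorner m = lowerCorner k + ((Pi.single 0 1 - Pi.single j 1) + -r) := by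
        ext i
        simp only [upperCorner, lowerCorner, Pi.add_apply, Pi.sub_apply, Pi.neg_apply,
          Pi.single_apply, r, Fin.ext_iff, Fin.le_def, Fin.lt_def, ne_eq]
        split_ifs <;> omega
      have hj0 : (0 : Fin n) ≠ j := fun h => by
        rw [← h] at hj
        omega
      rw [e] at hs
      refine not_sharesFacet_of_dotProduct_nonneg (by omega) (single_ne 0 (by simp [hj0]))
        (single_ne k (by simp [r, hjk])) ?_ hs
      rw [intComb_dotProduct_intComb hGram]
      have hinner : ∑ i, (Pi.single 0 1 - Pi.single j 1 : Fin n → ℤ) i * (-r) i = 0 := by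
        simp only [Pi.sub_apply, sub_mul, Finset.sum_sub_distrib, Pi.single_apply, ite_mul,
          one_mul, zero_mul, Finset.sum_ite_eq', Finset.mem_univ, if_true]
        simp [r]
      rw [hinner]
      simp [Pi.single_apply, Finset.sum_sub_distrib]
  · rintro (rfl | h)
    · rw [upperCorner_eq_lowerCorner_add]
      exact sharesFacet_add_single hG hGram _ _
    · rw [upperCorner_eq_of_val_eq_add_one h]
      refine sharesFacet_add_single_sub_single hG hGram _ fun he => ?_
      rw [← he] at h
      omega

lemma mem_cornerSet_one_and_bisector_iff
    (hGram : G * G.transpose = Matrix.of (fun _ _ => (1 : ℝ)) + 1) (x : Fin n → ℝ) :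
    (x ∈ cornerSet G 1 ∧ ∀ j k : Fin n, 1 ≤ (j : ℕ) → j < k →
      0 ≤ ∑ t, x t * (G j t - G k t)) ↔ ∃ m, intComb G (upperCorner m) = x := by
  constructor
  · rintro ⟨⟨z, hz, hz0, rfl⟩, h⟩
    simp only [vecMul_dotProduct_row_sub hGram, sub_nonneg] at h
    obtain ⟨m, hm⟩ := exists_forall_eq_ite_of_monotone hz h
    refine ⟨m, congrArg (· ᵥ* G) (funext fun i => ?_)⟩
    rcases eq_or_ne i 0 with rfl | hi
    · simp [upperCorner, hz0]
    · simp [upperCorner, hm i hi]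
  · rintro ⟨m, rfl⟩
    refine ⟨⟨_, fun i => ?_, ?_, rfl⟩, fun j k _ hjk => ?_⟩
    · by_cases h : i ≤ m <;> simp [upperCorner, h]
    · simp [upperCorner]
    · rw [intComb, vecMul_dotProduct_row_sub hGram, sub_nonneg, Int.cast_le]
      simp only [upperCorner]
      split_ifs with h₁ h₂ <;> first | exact absurd (hjk.le.trans h₁) h₂ | norm_num

lemma mem_cornerSet_zero_and_bisector_iff
    (hGram : G * G.transpose = Matrix.of (fun _ _ => (1 : ℝ)) + 1) (x : Fin n → ℝ) :
    (x ∈ cornerSet G 0 ∧ ∀ j k : Fin n, 1 ≤ (j : ℕ) → j < k →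
      0 ≤ ∑ t, x t * (G j t - G k t)) ↔ ∃ m, intComb G (lowerCorner m) = x := by
  constructor
  · rintro ⟨⟨z, hz, hz0, rfl⟩, h⟩
    simp only [vecMul_dotProduct_row_sub hGram, sub_nonneg] at h
    obtain ⟨m, hm⟩ := exists_forall_eq_ite_of_monotone hz h
    refine ⟨m, congrArg (· ᵥ* G) (funext fun i => ?_)⟩
    rcases eq_or_ne i 0 with rfl | hi
    · simp [lowerCorner, hz0]
    · simp [lowerCorner, hm i hi, hi]
  · rintro ⟨m, rfl⟩
    refine ⟨⟨_, fun i => ?_, ?_, rfl⟩, fun j k hj hjk => ?_⟩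
    · by_cases h : i ≠ 0 ∧ i ≤ m <;> simp [lowerCorner, h]
    · simp [lowerCorner]
    · have hj0 : j ≠ 0 := fun h => by simp [h] at hj
      rw [intComb, vecMul_dotProduct_row_sub hGram, sub_nonneg, Int.cast_le]
      simp only [lowerCorner]
      split_ifs with h₁ h₂ <;> first | exact absurd ⟨hj0, hjk.le.trans h₁.2⟩ h₂ | norm_num

end Pieces

lemma ncard_eq_or_val_eq_add_one (n : ℕ) [NeZero n] :
    Set.ncard {q : Fin n × Fin n | q.2 = q.1 ∨ (q.2 : ℕ) = q.1 + 1} = 2 * n - 1 := by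
  obtain ⟨k, rfl⟩ := Nat.exists_eq_succ_of_ne_zero (NeZero.ne n)
  have e : {q : Fin (k + 1) × Fin (k + 1) | q.2 = q.1 ∨ (q.2 : ℕ) = q.1 + 1}
      = Set.range (fun i : Fin (k + 1) => (i, i)) ∪
        Set.range (fun i : Fin k => (i.castSucc, i.succ)) := by
    ext ⟨a, b⟩
    simp only [Set.mem_ofPred_eq, Set.mem_union, Set.mem_range, Prod.mk.injEq]
    refine or_congr ⟨fun h => ⟨a, rfl, h.symm⟩, ?_⟩ ⟨fun h => ⟨⟨a, by omega⟩, ?_, ?_⟩, ?_⟩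
    · rintro ⟨i, rfl, rfl⟩
      rfl
    · rfl
    · exact Fin.ext h.symm
    · rintro ⟨i, rfl, rfl⟩
      simp
  rw [e, Set.ncard_union_eq, Set.ncard_range_of_injective, Set.ncard_range_of_injective]
  · simp
    omega
  · exact fun i j h => Fin.castSucc_injective _ (Prod.ext_iff.1 h).1
  · exact fun i j h => (Prod.ext_iff.1 h).1
  · rw [Set.disjoint_left]
    rintro _ ⟨i, rfl⟩ ⟨j, hj⟩
    simp only [Prod.mk.injEq, Fin.ext_iff, Fin.val_castSucc, Fin.val_succ] at hj
    omega

/-- for the `Aₙ` basis (Gram matrix `Jₙ + Iₙ`), exactly `2n − 1` pairs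
`(x, x')` with `x ∈ C¹` and `x' ∈ T_f(x) ∩ C⁰` have both `x` and `x'` on the non-negative
side of every bisector hyperplane `BH(g_j, g_k)`, `2 ≤ j < k ≤ n` (0-based: `1 ≤ j < k`).
This is the number of affine pieces of the decision boundary left after folding. -/
theorem An_pieces_after_folding (n : ℕ) [NeZero n]
    (G : Matrix (Fin n) (Fin n) ℝ) (hG : IsUnit G.det)
    (hGram : G * G.transpose = Matrix.of (fun _ _ => (1 : ℝ)) + 1) :
    Set.ncard {p : (Fin n → ℝ) × (Fin n → ℝ) |
        p.1 ∈ cornerSet G 1 ∧ p.2 ∈ cornerSet G 0 ∧ sharesFacet G p.1 p.2 ∧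
        ∀ j k : Fin n, 1 ≤ (j : ℕ) → j < k →
          0 ≤ ∑ t, p.1 t * (G j t - G k t) ∧ 0 ≤ ∑ t, p.2 t * (G j t - G k t)}
      = 2 * n - 1 := by
  rw [← ncard_eq_or_val_eq_add_one n, ← Set.ncard_image_of_injective
    {q : Fin n × Fin n | q.2 = q.1 ∨ (q.2 : ℕ) = q.1 + 1}
    (((intComb_injective G hG).comp upperCorner_injective).prodMap
      ((intComb_injective G hG).comp lowerCorner_injective))]
  congr 1
  ext ⟨x, y⟩
  constructor
  · rintro ⟨hx, hy, hs, h⟩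
    obtain ⟨m, rfl⟩ := (mem_cornerSet_one_and_bisector_iff hGram x).1
      ⟨hx, fun j k hj hjk => (h j k hj hjk).1⟩
    obtain ⟨k, rfl⟩ := (mem_cornerSet_zero_and_bisector_iff hGram y).1
      ⟨hy, fun j k hj hjk => (h j k hj hjk).2⟩
    exact ⟨(m, k), (sharesFacet_corner_iff hG hGram m k).1 hs, rfl⟩
  · rintro ⟨⟨m, k⟩, hmk, he⟩
    obtain ⟨rfl, rfl⟩ := Prod.ext_iff.1 he
    obtain ⟨hx, hx'⟩ := (mem_cornerSet_one_and_bisector_iff hGram _).2 ⟨m, rfl⟩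
    obtain ⟨hy, hy'⟩ := (mem_cornerSet_zero_and_bisector_iff hGram _).2 ⟨k, rfl⟩
    exact ⟨hx, hy, (sharesFacet_corner_iff hG hGram m k).2 hmk,
      fun j k hj hjk => ⟨hx' j k hj hjk, hy' j k hj hjk⟩⟩
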